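/- Let {a_n}, {b_n}, {c_n} be sequences of nonnegative real numbers such that Σ_{n=1}^∞ b_n < ∞ and Σ_{n=1}^∞ c_n < ∞. If a_{n+1} ≤ (1 + b_n) a_n + c_n for all n ≥ 1, then lim_{n→∞} a_n exists. -/

import Mathlib

theorem stmt6 (a b c : ℕ → ℝ)
    (ha : ∀ n, 0 ≤ a n) (hb : ∀ n, 0 ≤ b n) (hc : ∀ n, 0 ≤ c n)
    (hbs : Summable b) (hcs : Summable c)
    (hrec : ∀ n : ℕ, 1 ≤ n → a (n + 1) ≤ (1 + b n) * a n + c n) :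
    ∃ L : ℝ, Filter.Tendsto a Filter.atTop (nhds L) := by
  obtain ⟨P, hP⟩ : ∃ P : ℕ → ℝ, ∀ n, P n = ∏ i ∈ Finset.range n, (1 + b i) := ⟨_, fun _ => rfl⟩
  obtain ⟨S, hS⟩ : ∃ S : ℕ → ℝ, ∀ n, S n = ∑ i ∈ Finset.range n, c i := ⟨_, fun _ => rfl⟩
  have hP0 : P 0 = 1 := by simp [hP]
  have hPs : ∀ n, P (n + 1) = P n * (1 + b n) := fun n => by
    rw [hP, hP, Finset.prod_range_succ]
  have hSs : ∀ n, S (n + 1) = S n + c n := fun n => by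
    rw [hS, hS, Finset.sum_range_succ]
  have hP1 : ∀ n, 1 ≤ P n := by
    intro n
    induction n with
    | zero => exact hP0.ge
    | succ k ih => rw [hPs]; nlinarith [hb k]
  have hPm : Monotone P := monotone_nat_of_le_succ fun n => by
    rw [hPs]; nlinarith [hb n, hP1 n]
  have hPb : ∀ n, P n ≤ Real.exp (∑' i, b i) := by
    intro n
    rw [hP]
    calc ∏ i ∈ Finset.range n, (1 + b i) ≤ ∏ i ∈ Finset.range n, Real.exp (b i) :=
          Finset.prod_le_prod (fun i _ => by linarith [hb i])
            (fun i _ => by linarith [Real.add_one_le_exp (b i)])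
      _ = Real.exp (∑ i ∈ Finset.range n, b i) := (Real.exp_sum _ _).symm
      _ ≤ _ := Real.exp_le_exp.2 (hbs.sum_le_tsum _ fun i _ => hb i)
  have hPt := tendsto_atTop_ciSup hPm ⟨_, by rintro _ ⟨n, rfl⟩; exact hPb n⟩
  have hSt : Filter.Tendsto S Filter.atTop (nhds (∑' i, c i)) := by
    rw [funext hS]; exact hcs.hasSum.tendsto_sum_nat
  have hd : Antitone (fun n => a (n + 1) / P (n + 1) - S (n + 1)) := by
    refine antitone_nat_of_succ_le fun n => ?_
    have h := hrec (n + 1) (by omega)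
    have h1 := hP1 (n + 1)
    have h2 := hP1 (n + 1 + 1)
    have hbn := hb (n + 1)
    have hp : 0 < P (n + 1) := by linarith
    have key : a (n + 1 + 1) / P (n + 1 + 1) ≤ a (n + 1) / P (n + 1) + c (n + 1) := by
      rw [div_le_iff₀ (by linarith)]
      have e : a (n + 1) / P (n + 1) * P (n + 1 + 1) = (1 + b (n + 1)) * a (n + 1) := by
        rw [hPs (n + 1)]; field_simp
      rw [add_mul, e]
      nlinarith [hc (n + 1)]
    rw [hSs (n + 1)]
    linarith
  have hdt := tendsto_atTop_ciInf hd ⟨-(∑' i, c i), by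
    rintro _ ⟨n, rfl⟩
    have h1 : 0 ≤ a (n + 1) / P (n + 1) :=
      div_nonneg (ha _) (by linarith [hP1 (n + 1)])
    have h2 : S (n + 1) ≤ ∑' i, c i := by
      rw [hS]; exact hcs.sum_le_tsum _ fun i _ => hc i
    show _ ≤ a (n + 1) / P (n + 1) - S (n + 1)
    linarith⟩
  refine ⟨_, (Filter.tendsto_add_atTop_iff_nat 1).1
    (Filter.Tendsto.congr (fun n => ?_)
      ((hdt.add ((Filter.tendsto_add_atTop_iff_nat 1).2 hSt)).mul
        ((Filter.tendsto_add_atTop_iff_nat 1).2 hPt)))⟩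
  have h1 : P (n + 1) ≠ 0 := by linarith [hP1 (n + 1)]
  show (a (n + 1) / P (n + 1) - S (n + 1) + S (n + 1)) * P (n + 1) = a (n + 1)
  rw [sub_add_cancel, div_mul_cancel₀ _ h1]
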